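/- Let u1 ∈ L^2(R^3), u2, u3 ∈ Ḣ^1(R^3), and W ∈ L^{3,∞}(R^3). Then W · F(u1 u2) ∈ L^{3/2,∞}(R^3) and ‖ (F̄(W) * (u1 u2)) · u3 ‖_{L^2} ≤ C ‖W‖_{L^{3,∞}} ‖u1‖_{L^2} ‖u2‖_{Ḣ^1} ‖u3‖_{Ḣ^1} for a universal constant C. -/

import Mathlib

noncomputable section
open MeasureTheory
open scoped ENNReal

abbrev E3 : Type := EuclideanSpace ℝ (Fin 3)

/-- The weak Lorentz quasi-norm `‖f‖_{L^{p,∞}} = sup_{t>0} t · λ({|f|>t})^{1/p}`. -/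
def wLp {F : Type} [Norm F] (p : ℝ) (f : E3 → F) : ℝ≥0∞ :=
  ⨆ (t : ℝ) (_ : 0 < t), ENNReal.ofReal t * volume {k : E3 | t < ‖f k‖} ^ (1 / p)

/-- `F(u₁u₂) = (2π)⁻³ û₁ * û₂` computed from the Fourier transforms `û₁, û₂`. -/
def Fprod (hu1 hu2 : E3 → ℂ) (k : E3) : ℂ :=
  ((2 * Real.pi)⁻¹ ^ 3 : ℝ) * ∫ m : E3, hu1 m * hu2 (k - m)

/-- `‖u‖_{Ḣ¹} = ‖ |k| F(u)(k) ‖_{L²}`, in terms of the Fourier transform `û`. -/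
def hdotNorm (hu : E3 → ℂ) : ℝ≥0∞ :=
  eLpNorm (fun k : E3 => (‖k‖ : ℂ) * hu k) 2 volume

/-- Cauchy–Schwarz for nonnegative functions. -/
lemma sq_lintegral_mul_le {α : Type*} [MeasurableSpace α] (μ : Measure α) {f g : α → ℝ≥0∞}
    (hf : AEMeasurable f μ) (hg : AEMeasurable g μ) :
    (∫⁻ a, f a * g a ∂μ) ^ 2 ≤ (∫⁻ a, f a ^ 2 ∂μ) * ∫⁻ a, g a ^ 2 ∂μ := by
  have h := ENNReal.lintegral_mul_le_Lp_mul_Lq μ Real.HolderConjugate.two_two hf hg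
  simp only [Pi.mul_apply, ENNReal.rpow_two] at h
  calc _ ≤ ((∫⁻ a, f a ^ 2 ∂μ) ^ (1 / 2 : ℝ) * (∫⁻ a, g a ^ 2 ∂μ) ^ (1 / 2 : ℝ)) ^ 2 := by gcongr
    _ = _ := by
      rw [mul_pow]
      simp only [← ENNReal.rpow_two, ← ENNReal.rpow_mul]
      norm_num

/-- Weighted Cauchy–Schwarz for nonnegative functions. -/
lemma sq_lintegral_weight_mul_le {α : Type*} [MeasurableSpace α] (μ : Measure α)
    {w f g : α → ℝ≥0∞} (hw : AEMeasurable w μ) (hf : AEMeasurable f μ) (hg : AEMeasurable g μ) :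
    (∫⁻ a, w a * (f a * g a) ∂μ) ^ 2 ≤
      (∫⁻ a, w a * f a ^ 2 ∂μ) * ∫⁻ a, w a * g a ^ 2 ∂μ := by
  have hs : ∀ x : ℝ≥0∞, (x ^ (1 / 2 : ℝ)) ^ 2 = x := fun x => by
    rw [← ENNReal.rpow_two, ← ENNReal.rpow_mul]
    norm_num
  convert sq_lintegral_mul_le μ ((hw.pow_const (1 / 2 : ℝ)).mul hf)
    ((hw.pow_const (1 / 2 : ℝ)).mul hg) using 4 with a a a
  · simp only [Pi.mul_apply]
    nth_rw 1 [← hs (w a)]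
    ring
  · simp only [Pi.mul_apply, mul_pow, hs]
  · simp only [Pi.mul_apply, mul_pow, hs]

/-- Convolution of nonnegative functions on `ℝ³`. -/
def lconv (h v : E3 → ℝ≥0∞) (m : E3) : ℝ≥0∞ := ∫⁻ p, h p * v (m - p)

lemma measurable_lconv {h v : E3 → ℝ≥0∞} (hh : Measurable h) (hv : Measurable v) :
    Measurable (lconv h v) := by
  unfold lconv
  exact Measurable.lintegral_prod_right' (f := fun z : E3 × E3 => h z.2 * v (z.1 - z.2))
    (by fun_prop)

/-- Young's inequality `L² * L¹ ⊂ L²`. -/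
lemma lintegral_lconv_sq_le {h v : E3 → ℝ≥0∞} (hh : Measurable h) (hv : Measurable v) :
    ∫⁻ m, lconv h v m ^ 2 ≤ (∫⁻ p, h p ^ 2) * (∫⁻ q, v q) ^ 2 := by
  have hpt : ∀ m, lconv h v m ^ 2 ≤ (∫⁻ p, v (m - p) * h p ^ 2) * ∫⁻ q, v q := fun m => by
    have := sq_lintegral_weight_mul_le volume (w := fun p => v (m - p)) (f := h)
      (g := fun _ => 1) (by fun_prop) (by fun_prop) (by fun_prop)
    simp only [mul_one, one_pow, lintegral_sub_left_eq_self] at this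
    simpa only [lconv, mul_comm] using this
  calc _ ≤ ∫⁻ m, (∫⁻ p, v (m - p) * h p ^ 2) * ∫⁻ q, v q := lintegral_mono hpt
    _ = (∫⁻ p, ∫⁻ m, v (m - p) * h p ^ 2) * ∫⁻ q, v q := by
      rw [lintegral_mul_const, lintegral_lintegral_swap]
      · fun_prop
      · exact Measurable.lintegral_prod_right'
          (f := fun z : E3 × E3 => v (z.1 - z.2) * h z.2 ^ 2) (by fun_prop)
    _ = _ := by
      have : ∀ p, ∫⁻ m, v (m - p) * h p ^ 2 = (∫⁻ q, v q) * h p ^ 2 := fun p => by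
        rw [lintegral_mul_const _ (by fun_prop), lintegral_sub_right_eq_self]
      simp_rw [this]
      rw [lintegral_const_mul _ (by fun_prop)]
      ring

/-- The pointwise Cauchy–Schwarz bound `L² * L² ⊂ L^∞`. -/
lemma lconv_sq_le {h v : E3 → ℝ≥0∞} (hh : Measurable h) (hv : Measurable v) (m : E3) :
    lconv h v m ^ 2 ≤ (∫⁻ p, h p ^ 2) * ∫⁻ q, v q ^ 2 := by
  have := sq_lintegral_mul_le volume (f := h) (g := fun p => v (m - p)) (by fun_prop) (by fun_prop)
  rwa [lintegral_sub_left_eq_self (fun q => v q ^ 2)] at this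

/-- The constant in the integral of `|q|^{-5/2}` over a ball. -/
def ballConst : ℝ := 6 * (volume : Measure E3).real (Metric.ball 0 1)

lemma ballConst_nonneg : 0 ≤ ballConst := by unfold ballConst; positivity

lemma integral_Ioo_rpow {a : ℝ} (ha : 0 < a) :
    IntegrableOn (fun s : ℝ => s ^ (-1 / 2 : ℝ)) (Set.Ioo 0 a) ∧
      ∫ s in Set.Ioo 0 a, s ^ (-1 / 2 : ℝ) = 2 * a ^ (1 / 2 : ℝ) := by
  constructor
  · exact ((intervalIntegrable_iff_integrableOn_Ioo_of_le ha.le).1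
      (intervalIntegral.intervalIntegrable_rpow' (by norm_num)))
  · rw [← integral_Ioc_eq_integral_Ioo, ← intervalIntegral.integral_of_le ha.le,
      integral_rpow (Or.inl (by norm_num))]
    norm_num [Real.zero_rpow]
    ring

lemma lintegral_ball_rpow {R : ℝ} (hR : 0 < R) :
    ∫⁻ q : E3 in Metric.ball 0 R, ENNReal.ofReal (‖q‖ ^ (-5 / 2 : ℝ)) =
      ENNReal.ofReal (ballConst * R ^ (1 / 2 : ℝ)) := by
  have hpow : ∀ y ∈ Set.Ioo 0 R, y ^ (3 - 1) • y ^ (-5 / 2 : ℝ) = y ^ (-1 / 2 : ℝ) := by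
    intro y hy
    rw [smul_eq_mul, ← Real.rpow_natCast, ← Real.rpow_add hy.1]
    norm_num
  have hint : IntegrableOn (fun q : E3 => ‖q‖ ^ (-5 / 2 : ℝ)) (Metric.ball 0 R) := by
    rw [integrableOn_fun_norm_addHaar volume (f := fun y => y ^ (-5 / 2 : ℝ)),
      finrank_euclideanSpace_fin, integrableOn_congr_fun hpow measurableSet_Ioo]
    exact (integral_Ioo_rpow hR).1
  rw [← ofReal_integral_eq_lintegral_ofReal hint (ae_of_all _ fun q => by positivity)]
  congr 1
  have hind : ∀ q : E3, (Metric.ball (0 : E3) R).indicator (fun q => ‖q‖ ^ (-5 / 2 : ℝ)) q =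
      (Set.Iio R).indicator (fun y => y ^ (-5 / 2 : ℝ)) ‖q‖ := fun q => by
    simp [Set.indicator]
  have hind' : ∀ y : ℝ, y ^ (3 - 1) • (Set.Iio R).indicator (fun y => y ^ (-5 / 2 : ℝ)) y =
      (Set.Iio R).indicator (fun y : ℝ => y ^ (3 - 1) • y ^ (-5 / 2 : ℝ)) y := fun y => by
    by_cases h : y < R <;> simp [Set.indicator, h]
  rw [← integral_indicator measurableSet_ball]
  simp_rw [hind]
  rw [integral_fun_norm_addHaar, finrank_euclideanSpace_fin]
  simp_rw [hind']
  rw [setIntegral_indicator measurableSet_Iio, Set.Ioi_inter_Iio,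
    setIntegral_congr_fun measurableSet_Ioo hpow, (integral_Ioo_rpow hR).2]
  simp only [ballConst, nsmul_eq_mul, smul_eq_mul]
  push_cast
  ring

/-- Kernel produced by splitting a convolution with `v` at radius `A / s`. -/
def splitKernel (A s : ℝ) (q : E3) : ℝ≥0∞ :=
  if ‖q‖ * s < A then ENNReal.ofReal (ballConst * (A / s) ^ (1 / 2 : ℝ) * ‖q‖ ^ (5 / 2 : ℝ))
  else ENNReal.ofReal ((A / s) ^ 3)

lemma measurable_splitKernel (A : ℝ) : Measurable fun z : ℝ × E3 => splitKernel A z.1 z.2 := by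
  unfold splitKernel
  refine Measurable.ite (measurableSet_lt (by fun_prop) (by fun_prop)) ?_ ?_ <;> fun_prop

lemma measurable_splitKernel_left (A : ℝ) (q : E3) : Measurable fun s => splitKernel A s q := by
  unfold splitKernel
  refine Measurable.ite (measurableSet_lt (by fun_prop) (by fun_prop)) ?_ ?_ <;> fun_prop

lemma lintegral_splitKernel {A : ℝ} (hA : 0 < A) {q : E3} (hq : q ≠ 0) :
    ∫⁻ s in Set.Ioi 0, splitKernel A s q =
      ENNReal.ofReal ((2 * ballConst + 1 / 2) * A) * ‖q‖ₑ ^ 2 := by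
  have hq' : 0 < ‖q‖ := norm_pos_iff.2 hq
  have ha : 0 < A / ‖q‖ := by positivity
  have hb := ballConst_nonneg
  rw [← Set.Ioo_union_Ici_eq_Ioi ha, lintegral_union measurableSet_Ici
    (Set.disjoint_left.2 fun x hx hx' => absurd hx.2 (not_lt.2 hx'))]
  have h1 : ∫⁻ s in Set.Ioo 0 (A / ‖q‖), splitKernel A s q =
      ENNReal.ofReal (2 * ballConst * A * ‖q‖ ^ 2) := by
    have : ∀ s ∈ Set.Ioo 0 (A / ‖q‖), splitKernel A s q =
        ENNReal.ofReal ((ballConst * A ^ (1 / 2 : ℝ) * ‖q‖ ^ (5 / 2 : ℝ)) * s ^ (-1 / 2 : ℝ)) := by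
      intro s hs
      have hlt : ‖q‖ * s < A := by rw [mul_comm]; exact (lt_div_iff₀ hq').1 hs.2
      rw [splitKernel, if_pos hlt, Real.div_rpow hA.le hs.1.le, neg_div, Real.rpow_neg hs.1.le]
      congr 1
      ring
    rw [setLIntegral_congr_fun measurableSet_Ioo this, ← ofReal_integral_eq_lintegral_ofReal
      ((integral_Ioo_rpow ha).1.const_mul _), integral_const_mul, (integral_Ioo_rpow ha).2,
      Real.div_rpow hA.le hq'.le]
    · congr 1
      have e1 : A ^ (1 / 2 : ℝ) * A ^ (1 / 2 : ℝ) = A := by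
        rw [← Real.rpow_add hA]; norm_num
      have e2 : ‖q‖ ^ (5 / 2 : ℝ) = ‖q‖ ^ 2 * ‖q‖ ^ (1 / 2 : ℝ) := by
        rw [← Real.rpow_natCast, ← Real.rpow_add hq']; norm_num
      have e3 : ‖q‖ ^ (1 / 2 : ℝ) ≠ 0 := by positivity
      rw [e2]
      field_simp
      rw [← Real.rpow_natCast, ← Real.rpow_mul hA.le]
      norm_num
    · filter_upwards [ae_restrict_mem measurableSet_Ioo] with s hs
      have := hs.1
      positivity
  have h2 : ∫⁻ s in Set.Ici (A / ‖q‖), splitKernel A s q =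
      ENNReal.ofReal (1 / 2 * A * ‖q‖ ^ 2) := by
    have : ∀ s ∈ Set.Ioi (A / ‖q‖), splitKernel A s q =
        ENNReal.ofReal (A ^ 3 * s ^ (-3 : ℝ)) := by
      intro s hs
      have hs0 : 0 < s := ha.trans hs
      have hlt : ¬ ‖q‖ * s < A := by
        rw [not_lt, mul_comm]; exact (div_le_iff₀ hq').1 (le_of_lt hs)
      rw [splitKernel, if_neg hlt, Real.rpow_neg hs0.le, div_pow]
      norm_cast
    rw [setLIntegral_congr Ioi_ae_eq_Ici.symm, setLIntegral_congr_fun measurableSet_Ioi this,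
      ← ofReal_integral_eq_lintegral_ofReal
      ((integrableOn_Ioi_rpow_of_lt (by norm_num) ha).const_mul _), integral_const_mul,
      integral_Ioi_rpow_of_lt (by norm_num) ha]
    · congr 1
      have : (A / ‖q‖) ^ (-3 + 1 : ℝ) = ((A / ‖q‖) ^ 2)⁻¹ := by
        rw [← Real.rpow_natCast, ← Real.rpow_neg ha.le]; norm_num
      rw [this]
      field_simp
      norm_num
    · filter_upwards [ae_restrict_mem measurableSet_Ioi] with s hs
      have : 0 < s := ha.trans hs
      positivity
  rw [h1, h2, ← ofReal_norm, ← ENNReal.ofReal_pow hq'.le,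
    ← ENNReal.ofReal_mul (by positivity), ← ENNReal.ofReal_add (by positivity) (by positivity)]
  congr 1
  ring

/-- Splitting the convolution at radius `A / s` on a superlevel set. -/
lemma setLIntegral_lconv_sq_le {A s : ℝ} (hA : 0 < A) (hs : 0 < s) {S : Set E3}
    (hS : volume S ≤ ENNReal.ofReal ((A / s) ^ 3))
    {h v : E3 → ℝ≥0∞} (hh : Measurable h) (hv : Measurable v) :
    ∫⁻ m in S, lconv h v m ^ 2 ≤
      2 * (∫⁻ p, h p ^ 2) * ∫⁻ q, v q ^ 2 * splitKernel A s q := by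
  have hR : 0 < A / s := by positivity
  set B : Set E3 := Metric.ball 0 (A / s) with hB
  have hBm : MeasurableSet B := measurableSet_ball
  have hmem : ∀ q : E3, q ∈ B ↔ ‖q‖ * s < A := fun q => by
    rw [hB, mem_ball_zero_iff, lt_div_iff₀ hs]
  set v₁ := B.indicator v with hv₁
  set v₂ := Bᶜ.indicator v with hv₂
  have hv₁m : Measurable v₁ := hv.indicator hBm
  have hv₂m : Measurable v₂ := hv.indicator hBm.compl
  have hsplit : ∀ m, lconv h v m = lconv h v₁ m + lconv h v₂ m := fun m => by
    simp only [lconv]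
    rw [← lintegral_add_left (by fun_prop)]
    refine lintegral_congr fun p => ?_
    rw [← mul_add, ← Pi.add_apply v₁ v₂, hv₁, hv₂, Set.indicator_self_add_compl]
  have hsq : ∀ m, lconv h v m ^ 2 ≤ 2 * lconv h v₁ m ^ 2 + 2 * lconv h v₂ m ^ 2 := fun m => by
    rw [hsplit m, ← mul_add]
    have := ENNReal.rpow_add_le_mul_rpow_add_rpow (lconv h v₁ m) (lconv h v₂ m) one_le_two
    rw [show (2 : ℝ) - 1 = 1 by norm_num, ENNReal.rpow_one] at this
    simpa only [ENNReal.rpow_two] using this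
  have hker₁ : ∫⁻ q in B, v q ^ 2 * splitKernel A s q =
      ENNReal.ofReal (ballConst * (A / s) ^ (1 / 2 : ℝ)) *
        ∫⁻ q in B, v q ^ 2 * ENNReal.ofReal (‖q‖ ^ (5 / 2 : ℝ)) := by
    have hb := ballConst_nonneg
    rw [← lintegral_const_mul _ (by fun_prop)]
    refine setLIntegral_congr_fun hBm fun q hq => ?_
    simp only [splitKernel]
    rw [if_pos ((hmem q).1 hq), ENNReal.ofReal_mul (by positivity)]
    ring
  have hker₂ : ∫⁻ q in Bᶜ, v q ^ 2 * splitKernel A s q =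
      ENNReal.ofReal ((A / s) ^ 3) * ∫⁻ q, v₂ q ^ 2 := by
    have : ∀ q, v₂ q ^ 2 = Bᶜ.indicator (fun q => v q ^ 2) q := fun q => by
      by_cases hq : q ∈ Bᶜ <;> simp [hv₂, hq]
    simp_rw [this]
    rw [lintegral_indicator hBm.compl, ← lintegral_const_mul _ (by fun_prop)]
    refine setLIntegral_congr_fun hBm.compl fun q hq => ?_
    simp only [splitKernel]
    rw [if_neg (fun h' => hq ((hmem q).2 h')), mul_comm]
  have hL1 : (∫⁻ q, v₁ q) ^ 2 ≤ ∫⁻ q in B, v q ^ 2 * splitKernel A s q := by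
    have hne : ∀ᵐ q : E3 ∂volume.restrict B, q ≠ 0 :=
      ae_restrict_of_ae (compl_mem_ae_iff.2 (measure_singleton 0))
    have hinv : ∀ q : E3, q ≠ 0 →
        ENNReal.ofReal (‖q‖ ^ (-5 / 2 : ℝ)) * ENNReal.ofReal (‖q‖ ^ (5 / 2 : ℝ)) = 1 := by
      intro q hq
      rw [← ENNReal.ofReal_mul (by positivity), ← Real.rpow_add (norm_pos_iff.2 hq)]
      norm_num
    have := sq_lintegral_weight_mul_le (volume.restrict B)
      (w := fun q => ENNReal.ofReal (‖q‖ ^ (-5 / 2 : ℝ))) (f := fun _ => 1)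
      (g := fun q => v q * ENNReal.ofReal (‖q‖ ^ (5 / 2 : ℝ)))
      (by fun_prop) (by fun_prop) (by fun_prop)
    rw [hker₁, hv₁, lintegral_indicator hBm, ← lintegral_ball_rpow hR]
    convert this using 2
    · refine lintegral_congr_ae (hne.mono fun q hq => ?_)
      calc v q = v q * (ENNReal.ofReal (‖q‖ ^ (-5 / 2 : ℝ)) *
            ENNReal.ofReal (‖q‖ ^ (5 / 2 : ℝ))) := by rw [hinv q hq, mul_one]
        _ = _ := by ring
    · simp only [one_pow, mul_one, hB]
    · refine lintegral_congr_ae (hne.mono fun q hq => ?_)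
      calc v q ^ 2 * ENNReal.ofReal (‖q‖ ^ (5 / 2 : ℝ)) =
            v q ^ 2 * ENNReal.ofReal (‖q‖ ^ (5 / 2 : ℝ)) *
            (ENNReal.ofReal (‖q‖ ^ (-5 / 2 : ℝ)) *
            ENNReal.ofReal (‖q‖ ^ (5 / 2 : ℝ))) := by rw [hinv q hq, mul_one]
        _ = _ := by ring
  have hlow : ∫⁻ m in S, lconv h v₁ m ^ 2 ≤
      (∫⁻ p, h p ^ 2) * ∫⁻ q in B, v q ^ 2 * splitKernel A s q :=
    calc _ ≤ ∫⁻ m, lconv h v₁ m ^ 2 := setLIntegral_le_lintegral _ _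
      _ ≤ _ := lintegral_lconv_sq_le hh hv₁m
      _ ≤ _ := by gcongr
  have hhigh : ∫⁻ m in S, lconv h v₂ m ^ 2 ≤
      (∫⁻ p, h p ^ 2) * ∫⁻ q in Bᶜ, v q ^ 2 * splitKernel A s q :=
    calc _ ≤ ∫⁻ _ in S, (∫⁻ p, h p ^ 2) * ∫⁻ q, v₂ q ^ 2 :=
          lintegral_mono fun m => lconv_sq_le hh hv₂m m
      _ = ((∫⁻ p, h p ^ 2) * ∫⁻ q, v₂ q ^ 2) * volume S := by
        rw [setLIntegral_const]
      _ ≤ ((∫⁻ p, h p ^ 2) * ∫⁻ q, v₂ q ^ 2) * ENNReal.ofReal ((A / s) ^ 3) := by gcongr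
      _ = _ := by rw [hker₂]; ring
  have hm₁ := measurable_lconv hh hv₁m
  have hm₂ := measurable_lconv hh hv₂m
  calc _ ≤ ∫⁻ m in S, (2 * lconv h v₁ m ^ 2 + 2 * lconv h v₂ m ^ 2) := lintegral_mono hsq
    _ = 2 * (∫⁻ m in S, lconv h v₁ m ^ 2) + 2 * ∫⁻ m in S, lconv h v₂ m ^ 2 := by
      rw [lintegral_add_left (by fun_prop), lintegral_const_mul _ (by fun_prop),
        lintegral_const_mul _ (by fun_prop)]
    _ ≤ 2 * ((∫⁻ p, h p ^ 2) * ∫⁻ q in B, v q ^ 2 * splitKernel A s q) +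
        2 * ((∫⁻ p, h p ^ 2) * ∫⁻ q in Bᶜ, v q ^ 2 * splitKernel A s q) := by gcongr
    _ = _ := by
      rw [← lintegral_add_compl (μ := volume) (fun q => v q ^ 2 * splitKernel A s q) hBm]
      ring

/-- The universal constant of the weighted estimate. -/
def weightConst : ℝ := 4 * ballConst + 1

/-- The weighted estimate: `L² * |·|⁻¹L²` embeds into `L²(|W|)` for `W ∈ L^{3,∞}`. -/
lemma lintegral_weight_lconv_sq_le {A : ℝ} (hA : 0 < A) {W : E3 → ℝ} (hWm : Measurable W)
    (hW : ∀ s, 0 < s → volume {m | s < ‖W m‖} ≤ ENNReal.ofReal ((A / s) ^ 3))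
    {h v : E3 → ℝ≥0∞} (hh : Measurable h) (hv : Measurable v) :
    ∫⁻ m, ‖W m‖ₑ * lconv h v m ^ 2 ≤
      ENNReal.ofReal (weightConst * A) * (∫⁻ p, h p ^ 2) * ∫⁻ q, ‖q‖ₑ ^ 2 * v q ^ 2 := by
  have hK := (measurable_lconv hh hv).pow_const 2
  have hk := measurable_splitKernel A
  have hvk : Measurable fun z : ℝ × E3 => v z.2 ^ 2 * splitKernel A z.1 z.2 :=
    ((hv.comp measurable_snd).pow_const 2).mul hk
  have hlayer : ∫⁻ m, ‖W m‖ₑ * lconv h v m ^ 2 =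
      ∫⁻ s in Set.Ioi 0, ∫⁻ m in {m | s < ‖W m‖}, lconv h v m ^ 2 := by
    have h1 := lintegral_eq_lintegral_meas_lt (volume.withDensity fun m => lconv h v m ^ 2)
      (f := fun m => ‖W m‖) (ae_of_all _ fun m => norm_nonneg _) hWm.norm.aemeasurable
    rw [lintegral_withDensity_eq_lintegral_mul _ hK (by fun_prop)] at h1
    simp only [Pi.mul_apply, ofReal_norm] at h1
    simp_rw [mul_comm (‖W _‖ₑ), h1]
    refine lintegral_congr fun s => ?_
    rw [withDensity_apply _ (measurableSet_lt measurable_const hWm.norm)]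
  have hinner : (fun q => ∫⁻ s in Set.Ioi 0, v q ^ 2 * splitKernel A s q) =ᵐ[volume]
      fun q => ENNReal.ofReal ((2 * ballConst + 1 / 2) * A) * (‖q‖ₑ ^ 2 * v q ^ 2) := by
    have hne : ∀ᵐ q : E3, q ≠ 0 := compl_mem_ae_iff.2 (measure_singleton 0)
    filter_upwards [hne] with q hq
    rw [lintegral_const_mul _ (measurable_splitKernel_left A q), lintegral_splitKernel hA hq]
    ring
  calc _ = ∫⁻ s in Set.Ioi 0, ∫⁻ m in {m | s < ‖W m‖}, lconv h v m ^ 2 := hlayer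
    _ ≤ ∫⁻ s in Set.Ioi 0, 2 * (∫⁻ p, h p ^ 2) * ∫⁻ q, v q ^ 2 * splitKernel A s q :=
      setLIntegral_mono' measurableSet_Ioi fun s hs =>
        setLIntegral_lconv_sq_le hA hs (hW s hs) hh hv
    _ = 2 * (∫⁻ p, h p ^ 2) * ∫⁻ q, ∫⁻ s in Set.Ioi 0, v q ^ 2 * splitKernel A s q := by
      rw [lintegral_const_mul, lintegral_lintegral_swap]
      · exact hvk.aemeasurable
      · exact hvk.lintegral_prod_right'
    _ = 2 * (∫⁻ p, h p ^ 2) *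
        ∫⁻ q, ENNReal.ofReal ((2 * ballConst + 1 / 2) * A) * (‖q‖ₑ ^ 2 * v q ^ 2) := by
      rw [lintegral_congr_ae hinner]
    _ = _ := by
      have hb := ballConst_nonneg
      have : ENNReal.ofReal (weightConst * A) =
          2 * ENNReal.ofReal ((2 * ballConst + 1 / 2) * A) := by
        rw [← ENNReal.ofReal_ofNat, ← ENNReal.ofReal_mul (by norm_num), weightConst]
        congr 1
        ring
      rw [lintegral_const_mul _ (by fun_prop), this]
      ring

/-- `L²` duality for nonnegative functions. -/
lemma lintegral_sq_le_of_forall {T : E3 → ℝ≥0∞} (hT : Measurable T) {M : ℝ≥0∞}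
    (hM : ∀ h : E3 → ℝ≥0∞, Measurable h → (∫⁻ k, T k * h k) ^ 2 ≤ M * ∫⁻ k, h k ^ 2) :
    ∫⁻ k, T k ^ 2 ≤ M := by
  let g : ℕ → E3 → ℝ≥0∞ := fun n => (Metric.ball 0 (n : ℝ)).indicator fun k => min (T k) n
  have hg : ∀ n, Measurable (g n) := fun n =>
    (hT.min measurable_const).indicator measurableSet_ball
  have hgT : ∀ n k, g n k ≤ T k := fun n k => by
    by_cases hk : k ∈ Metric.ball (0 : E3) n <;> simp [g, hk]
  have hmono : Monotone g := by
    intro i j hij k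
    have hij' : (i : ℝ≥0∞) ≤ j := by exact_mod_cast hij
    by_cases hk : k ∈ Metric.ball (0 : E3) i
    · have hk' : k ∈ Metric.ball (0 : E3) j :=
        Metric.ball_subset_ball (by exact_mod_cast hij) hk
      simp only [g, Set.indicator_of_mem hk, Set.indicator_of_mem hk']
      exact min_le_min_left _ hij'
    · simp [g, Set.indicator_of_notMem hk]
  have hbd : ∀ n, ∫⁻ k, g n k ^ 2 ≤ M := fun n => by
    have hfin : ∫⁻ k, g n k ^ 2 ≠ ∞ := by
      refine ne_top_of_le_ne_top (b := ∫⁻ _ in Metric.ball (0 : E3) n, (n : ℝ≥0∞) ^ 2) ?_ ?_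
      · rw [setLIntegral_const]
        exact ENNReal.mul_ne_top (by simp) measure_ball_lt_top.ne
      · rw [← lintegral_indicator measurableSet_ball]
        refine lintegral_mono fun k => ?_
        by_cases hk : k ∈ Metric.ball (0 : E3) n
        · simp only [g, Set.indicator_of_mem hk]
          gcongr
          exact min_le_right _ _
        · simp [g, Set.indicator_of_notMem hk]
    by_cases h0 : ∫⁻ k, g n k ^ 2 = 0
    · simp [h0]
    have hle : (∫⁻ k, g n k ^ 2) * ∫⁻ k, g n k ^ 2 ≤ M * ∫⁻ k, g n k ^ 2 := by
      refine le_trans ?_ (hM (g n) (hg n))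
      rw [← sq]
      gcongr with k
      rw [sq]
      gcongr
      exact hgT n k
    exact (ENNReal.mul_le_mul_iff_left h0 hfin).1 hle
  have hsup : ∀ k, T k ^ 2 = ⨆ n, g n k ^ 2 := fun k => by
    refine le_antisymm ?_ (iSup_le fun n => by gcongr; exact hgT n k)
    have hlim : Filter.Tendsto (fun n : ℕ => min (T k) (n : ℝ≥0∞)) Filter.atTop
        (nhds (min (T k) ∞)) := tendsto_const_nhds.min ENNReal.tendsto_nat_nhds_top
    rw [min_eq_left le_top] at hlim
    refine le_of_tendsto (((ENNReal.continuous_pow 2).tendsto _).comp hlim) ?_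
    obtain ⟨N, hN⟩ := exists_nat_gt ‖k‖
    filter_upwards [Filter.eventually_ge_atTop N] with n hn
    have hk : k ∈ Metric.ball (0 : E3) n := by
      rw [mem_ball_zero_iff]
      exact hN.trans_le (by exact_mod_cast hn)
    refine le_trans (le_of_eq ?_) (le_iSup (fun n => g n k ^ 2) n)
    simp [g, Set.indicator_of_mem hk]
  simp_rw [hsup]
  rw [lintegral_iSup (fun n => (hg n).pow_const 2)
    (fun i j hij k => pow_le_pow_left' (hmono hij k) 2)]
  exact iSup_le hbd

/-- The nonnegative form of the quadrilinear estimate. -/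
lemma lintegral_weight_lconv_lconv_sq_le {A : ℝ} (hA : 0 < A) {W : E3 → ℝ} (hWm : Measurable W)
    (hW : ∀ s, 0 < s → volume {m | s < ‖W m‖} ≤ ENNReal.ofReal ((A / s) ^ 3))
    {v₁ v₂ v₃ : E3 → ℝ≥0∞} (h₁ : Measurable v₁) (h₂ : Measurable v₂) (h₃ : Measurable v₃) :
    ∫⁻ k, (∫⁻ m, ‖W m‖ₑ * lconv v₁ v₂ m * v₃ (k - m)) ^ 2 ≤
      ENNReal.ofReal (weightConst * A) ^ 2 * (∫⁻ p, v₁ p ^ 2) *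
        (∫⁻ q, ‖q‖ₑ ^ 2 * v₂ q ^ 2) * ∫⁻ q, ‖q‖ₑ ^ 2 * v₃ q ^ 2 := by
  have hK := measurable_lconv h₁ h₂
  refine lintegral_sq_le_of_forall (Measurable.lintegral_prod_right'
    (f := fun z : E3 × E3 => ‖W z.2‖ₑ * lconv v₁ v₂ z.2 * v₃ (z.1 - z.2)) (by fun_prop))
    fun h hh => ?_
  set v₃' : E3 → ℝ≥0∞ := fun q => v₃ (-q) with hv₃'
  have h₃' : Measurable v₃' := by fun_prop
  have hK' := measurable_lconv hh h₃'
  have hswap : ∫⁻ k, (∫⁻ m, ‖W m‖ₑ * lconv v₁ v₂ m * v₃ (k - m)) * h k =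
      ∫⁻ m, ‖W m‖ₑ * (lconv v₁ v₂ m * lconv h v₃' m) := by
    calc _ = ∫⁻ k, ∫⁻ m, ‖W m‖ₑ * lconv v₁ v₂ m * v₃ (k - m) * h k :=
          lintegral_congr fun k => (lintegral_mul_const _ (by fun_prop)).symm
      _ = ∫⁻ m, ∫⁻ k, ‖W m‖ₑ * lconv v₁ v₂ m * v₃ (k - m) * h k :=
        lintegral_lintegral_swap (by fun_prop)
      _ = _ := lintegral_congr fun m => by
        rw [← mul_assoc, lconv.eq_def h, ← lintegral_const_mul _ (by fun_prop)]
        refine lintegral_congr fun k => ?_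
        simp only [hv₃', neg_sub]
        ring
  have hneg : ∫⁻ q, ‖q‖ₑ ^ 2 * v₃' q ^ 2 = ∫⁻ q, ‖q‖ₑ ^ 2 * v₃ q ^ 2 := by
    rw [← lintegral_neg_eq_self (fun q => ‖q‖ₑ ^ 2 * v₃ q ^ 2)]
    simp [hv₃']
  rw [hswap]
  calc _ ≤ (∫⁻ m, ‖W m‖ₑ * lconv v₁ v₂ m ^ 2) * ∫⁻ m, ‖W m‖ₑ * lconv h v₃' m ^ 2 :=
        sq_lintegral_weight_mul_le _ (by fun_prop) (by fun_prop) (by fun_prop)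
    _ ≤ (ENNReal.ofReal (weightConst * A) * (∫⁻ p, v₁ p ^ 2) * ∫⁻ q, ‖q‖ₑ ^ 2 * v₂ q ^ 2) *
        (ENNReal.ofReal (weightConst * A) * (∫⁻ p, h p ^ 2) * ∫⁻ q, ‖q‖ₑ ^ 2 * v₃' q ^ 2) := by
      gcongr
      · exact lintegral_weight_lconv_sq_le hA hWm hW h₁ h₂
      · exact lintegral_weight_lconv_sq_le hA hWm hW hh h₃'
    _ = _ := by rw [hneg]; ring

lemma volume_lt_norm_le_of_wLp_le {F : Type} [Norm F] {f : E3 → F} {A : ℝ} (hA : 0 < A)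
    (hf : wLp 3 f ≤ ENNReal.ofReal A) {s : ℝ} (hs : 0 < s) :
    volume {m | s < ‖f m‖} ≤ ENNReal.ofReal ((A / s) ^ 3) := by
  have h1 : ENNReal.ofReal s * volume {m | s < ‖f m‖} ^ (1 / 3 : ℝ) ≤ ENNReal.ofReal A :=
    (le_iSup₂ (f := fun (t : ℝ) (_ : 0 < t) =>
      ENNReal.ofReal t * volume {k : E3 | t < ‖f k‖} ^ (1 / 3 : ℝ)) s hs).trans hf
  have h2 : volume {m | s < ‖f m‖} ^ (1 / 3 : ℝ) ≤ ENNReal.ofReal (A / s) := by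
    rw [ENNReal.ofReal_div_of_pos hs, ENNReal.le_div_iff_mul_le (by simp [hs]) (by simp), mul_comm]
    exact h1
  calc volume {m | s < ‖f m‖} = (volume {m | s < ‖f m‖} ^ (1 / 3 : ℝ)) ^ 3 := by
        rw [← ENNReal.rpow_natCast, ← ENNReal.rpow_mul]
        norm_num
    _ ≤ ENNReal.ofReal (A / s) ^ 3 := by gcongr
    _ = _ := (ENNReal.ofReal_pow (by positivity) _).symm

lemma eLpNorm_two_sq {F : Type} [NormedAddCommGroup F] (f : E3 → F) :
    eLpNorm f 2 volume ^ 2 = ∫⁻ k, ‖f k‖ₑ ^ 2 := by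
  rw [eLpNorm_eq_lintegral_rpow_enorm_toReal two_ne_zero ENNReal.ofNat_ne_top,
    ← ENNReal.rpow_two, ← ENNReal.rpow_mul]
  simp

lemma hdotNorm_sq (u : E3 → ℂ) : hdotNorm u ^ 2 = ∫⁻ k, ‖k‖ₑ ^ 2 * ‖u k‖ₑ ^ 2 := by
  rw [hdotNorm, eLpNorm_two_sq]
  refine lintegral_congr fun k => ?_
  rw [enorm_mul, mul_pow, ← ofReal_norm (k : E3), ← ofReal_norm ((‖k‖ : ℝ) : ℂ),
    Complex.norm_real, norm_norm]

lemma enorm_normalization_le : ‖(((2 * Real.pi)⁻¹ ^ 3 : ℝ) : ℂ)‖ₑ ≤ 1 := by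
  have hp : (2 * Real.pi)⁻¹ ≤ 1 := inv_le_one_of_one_le₀ (by linarith [Real.pi_gt_three])
  rw [← ofReal_norm, Complex.norm_real, Real.norm_of_nonneg (by positivity)]
  exact ENNReal.ofReal_le_one.2 (pow_le_one₀ (by positivity) hp)

lemma ae_eq_comp_sub_left {u v : E3 → ℂ} (h : u =ᵐ[volume] v) (k : E3) :
    (fun m => u (k - m)) =ᵐ[volume] fun m => v (k - m) :=
  (Measure.measurePreserving_sub_left volume k).quasiMeasurePreserving.ae_eq_comp h

lemma Fprod_congr {u₁ v₁ u₂ v₂ : E3 → ℂ} (h₁ : u₁ =ᵐ[volume] v₁) (h₂ : u₂ =ᵐ[volume] v₂) :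
    Fprod u₁ u₂ = Fprod v₁ v₂ := by
  funext k
  unfold Fprod
  congr 1
  exact integral_congr_ae (h₁.mul (ae_eq_comp_sub_left h₂ k))

lemma enorm_Fprod_le (u₁ u₂ : E3 → ℂ) (k : E3) :
    ‖Fprod u₁ u₂ k‖ₑ ≤ lconv (fun p => ‖u₁ p‖ₑ) (fun q => ‖u₂ q‖ₑ) k := by
  calc _ ≤ 1 * ∫⁻ m, ‖u₁ m * u₂ (k - m)‖ₑ := by
        rw [Fprod, enorm_mul]
        exact mul_le_mul' enorm_normalization_le (enorm_integral_le_lintegral_enorm _)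
    _ = _ := by simp only [one_mul, enorm_mul, lconv]

lemma wLp_congr {F : Type} [Norm F] {p : ℝ} {f g : E3 → F} (h : f =ᵐ[volume] g) :
    wLp p f = wLp p g := by
  unfold wLp
  refine iSup_congr fun t => iSup_congr fun _ => ?_
  congr 2
  refine measure_congr (h.mono fun k hk => ?_)
  exact congrArg (fun x => t < ‖x‖) hk

/-- If `W ∈ L^{3,∞}` and `∫ |W| K² < ∞`, then every `G` with `|G| ≤ K` satisfies
`W G ∈ L^{3/2,∞}`. -/
lemma wLp_mul_lt_top {A : ℝ} {W : E3 → ℝ} (hWm : Measurable W)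
    (hW : ∀ s, 0 < s → volume {m | s < ‖W m‖} ≤ ENNReal.ofReal ((A / s) ^ 3))
    {K : E3 → ℝ≥0∞} (hK : Measurable K) (hWK : ∫⁻ m, ‖W m‖ₑ * K m ^ 2 < ∞)
    {G : E3 → ℂ} (hG : ∀ m, ‖G m‖ₑ ≤ K m) :
    wLp (3 / 2) (fun k => ((W k : ℝ) : ℂ) * G k) < ∞ := by
  set I := ∫⁻ m, ‖W m‖ₑ * K m ^ 2 with hI
  have hfin : (ENNReal.ofReal (A ^ 3) + I) ^ (1 / (3 / 2) : ℝ) < ∞ :=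
    ENNReal.rpow_lt_top_of_nonneg (by norm_num) (ENNReal.add_lt_top.2 ⟨by simp, hWK⟩).ne
  refine lt_of_le_of_lt (iSup₂_le fun t ht => ?_) hfin
  set r : ℝ := t ^ (1 / 2 : ℝ) with hr
  have hr0 : 0 < r := by positivity
  have hrt : r ^ 2 = t := by
    rw [hr, ← Real.rpow_natCast, ← Real.rpow_mul ht.le]
    norm_num
  have hsub : {k | t < ‖((W k : ℝ) : ℂ) * G k‖} ⊆
      {k | r < ‖W k‖} ∪ {k | ENNReal.ofReal (r ^ 3) ≤ ‖W k‖ₑ * K k ^ 2} := by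
    intro k hk
    by_cases hkr : r < ‖W k‖
    · exact Or.inl hkr
    right
    rw [not_lt] at hkr
    simp only [Set.mem_ofPred_eq, norm_mul, Complex.norm_real] at hk ⊢
    have hreal : r ^ 3 ≤ ‖W k‖ * ‖G k‖ ^ 2 := by
      have h1 : r * r ^ 3 ≤ r * (‖W k‖ * ‖G k‖ ^ 2) :=
        calc r * r ^ 3 = t ^ 2 := by rw [← hrt]; ring
          _ ≤ (‖W k‖ * ‖G k‖) ^ 2 := by gcongr
          _ = ‖W k‖ * (‖W k‖ * ‖G k‖ ^ 2) := by ring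
          _ ≤ r * (‖W k‖ * ‖G k‖ ^ 2) := by gcongr
      exact le_of_mul_le_mul_left h1 hr0
    calc ENNReal.ofReal (r ^ 3) ≤ ENNReal.ofReal (‖W k‖ * ‖G k‖ ^ 2) :=
          ENNReal.ofReal_le_ofReal hreal
      _ = ‖W k‖ₑ * ‖G k‖ₑ ^ 2 := by
        rw [ENNReal.ofReal_mul (norm_nonneg _), ENNReal.ofReal_pow (norm_nonneg _), ofReal_norm,
          ofReal_norm]
      _ ≤ _ := by gcongr; exact hG k
  have hr3 : ENNReal.ofReal (r ^ 3) ≠ 0 := by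
    simp only [ne_eq, ENNReal.ofReal_eq_zero, not_le]
    positivity
  have hvol : volume {k | t < ‖((W k : ℝ) : ℂ) * G k‖} ≤
      (ENNReal.ofReal (A ^ 3) + I) / ENNReal.ofReal (r ^ 3) := by
    refine (measure_mono hsub).trans ((measure_union_le _ _).trans ?_)
    rw [ENNReal.add_div]
    gcongr
    · refine (hW r hr0).trans_eq ?_
      rw [div_pow, ENNReal.ofReal_div_of_pos (by positivity)]
    · rw [ENNReal.le_div_iff_mul_le (Or.inl hr3) (by simp), mul_comm]
      exact mul_meas_ge_le_lintegral (by fun_prop) _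
  have htr : ENNReal.ofReal t = ENNReal.ofReal (r ^ 3) ^ (1 / (3 / 2) : ℝ) := by
    rw [ENNReal.ofReal_rpow_of_nonneg (by positivity) (by norm_num), ← hrt,
      ← Real.rpow_natCast r 3, ← Real.rpow_mul hr0.le]
    norm_num
  calc _ ≤ ENNReal.ofReal t *
        ((ENNReal.ofReal (A ^ 3) + I) / ENNReal.ofReal (r ^ 3)) ^ (1 / (3 / 2) : ℝ) := by
        gcongr
    _ = _ := by
      rw [htr, ← ENNReal.mul_rpow_of_nonneg _ _ (by norm_num),
        ENNReal.mul_div_cancel hr3 (by simp)]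

/-- The statement of `conv_weakL3_L2` for measurable functions and an upper bound of
the weak norm of `W`. -/
lemma conv_weakL3_L2_of_measurable {A : ℝ} (hA : 0 < A) {W : E3 → ℝ} {u₁ u₂ u₃ : E3 → ℂ}
    (hWm : Measurable W) (h₁ : Measurable u₁) (h₂ : Measurable u₂) (h₃ : Measurable u₃)
    (hWA : wLp 3 W ≤ ENNReal.ofReal A) :
    (eLpNorm u₁ 2 volume < ∞ → hdotNorm u₂ < ∞ →
      wLp (3 / 2) (fun k : E3 => ((W k : ℝ) : ℂ) * Fprod u₁ u₂ k) < ∞) ∧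
    eLpNorm (fun k : E3 => ((2 * Real.pi)⁻¹ ^ 3 : ℝ) *
        ∫ m : E3, ((W m : ℝ) : ℂ) * Fprod u₁ u₂ m * u₃ (k - m)) 2 volume ≤
      ENNReal.ofReal (weightConst * A) * eLpNorm u₁ 2 volume * hdotNorm u₂ * hdotNorm u₃ := by
  have hW := fun s hs => volume_lt_norm_le_of_wLp_le (s := s) hA hWA hs
  have hv₁ : Measurable fun p => ‖u₁ p‖ₑ := h₁.enorm
  have hv₂ : Measurable fun p => ‖u₂ p‖ₑ := h₂.enorm
  have hv₃ : Measurable fun p => ‖u₃ p‖ₑ := h₃.enorm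
  constructor
  · intro hu₁ hu₂
    refine wLp_mul_lt_top hWm hW (measurable_lconv hv₁ hv₂) ?_ (enorm_Fprod_le u₁ u₂)
    refine (lintegral_weight_lconv_sq_le hA hWm hW hv₁ hv₂).trans_lt ?_
    rw [← eLpNorm_two_sq, ← hdotNorm_sq]
    exact ENNReal.mul_lt_top (ENNReal.mul_lt_top ENNReal.ofReal_lt_top (ENNReal.pow_lt_top hu₁))
      (ENNReal.pow_lt_top hu₂)
  · refine (ENNReal.pow_le_pow_left_iff two_ne_zero).1 ?_
    calc _ ≤ ∫⁻ k, (∫⁻ m, ‖W m‖ₑ * lconv (fun p => ‖u₁ p‖ₑ) (fun q => ‖u₂ q‖ₑ) m *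
          ‖u₃ (k - m)‖ₑ) ^ 2 := by
          rw [eLpNorm_two_sq]
          refine lintegral_mono fun k => ?_
          gcongr
          rw [enorm_mul, ← one_mul (∫⁻ m, _)]
          refine mul_le_mul' enorm_normalization_le
            ((enorm_integral_le_lintegral_enorm _).trans (lintegral_mono fun m => ?_))
          rw [enorm_mul, enorm_mul, ← ofReal_norm ((W m : ℝ) : ℂ), Complex.norm_real, ofReal_norm]
          gcongr
          exact enorm_Fprod_le u₁ u₂ m
      _ ≤ _ := lintegral_weight_lconv_lconv_sq_le hA hWm hW hv₁ hv₂ hv₃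
      _ = _ := by
        rw [← eLpNorm_two_sq, ← hdotNorm_sq, ← hdotNorm_sq]
        ring

lemma weightConst_pos : 0 < weightConst := by
  have := ballConst_nonneg
  unfold weightConst
  positivity

/-- For `u₁ ∈ L²`, `u₂, u₃ ∈ Ḣ¹` (all given via their Fourier transforms)
and `W ∈ L^{3,∞}`: `W · F(u₁u₂) ∈ L^{3/2,∞}` and
`‖(F̄(W) * (u₁u₂)) u₃‖_{L²} ≤ C ‖W‖_{L^{3,∞}} ‖u₁‖_{L²} ‖u₂‖_{Ḣ¹} ‖u₃‖_{Ḣ¹}`.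
On the Fourier side, `F((F̄(W)*(u₁u₂)) u₃) = (2π)⁻³ (W·F(u₁u₂)) * û₃`, and the `L²` norms
match up to a universal (normalization) constant absorbed in `C`. -/
theorem conv_weakL3_L2 :
    ∃ C : ℝ≥0∞, 0 < C ∧ C < ∞ ∧
      ∀ (W : E3 → ℝ) (hu1 hu2 hu3 : E3 → ℂ),
        AEMeasurable W volume → AEMeasurable hu1 volume → AEMeasurable hu2 volume →
        AEMeasurable hu3 volume →
        wLp 3 W < ∞ → eLpNorm hu1 2 volume < ∞ → hdotNorm hu2 < ∞ → hdotNorm hu3 < ∞ →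
        wLp (3 / 2) (fun k : E3 => ((W k : ℝ) : ℂ) * Fprod hu1 hu2 k) < ∞ ∧
        eLpNorm
            (fun k : E3 => ((2 * Real.pi)⁻¹ ^ 3 : ℝ) *
              ∫ m : E3, ((W m : ℝ) : ℂ) * Fprod hu1 hu2 m * hu3 (k - m)) 2 volume ≤
          C * wLp 3 W * eLpNorm hu1 2 volume * hdotNorm hu2 * hdotNorm hu3 := by
  refine ⟨ENNReal.ofReal weightConst, ENNReal.ofReal_pos.2 weightConst_pos,
    ENNReal.ofReal_lt_top, ?_⟩
  intro W u₁ u₂ u₃ hW h₁ h₂ h₃ hWfin hu₁ hu₂ hu₃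
  have hmain : ∀ A : ℝ, 0 < A → wLp 3 W ≤ ENNReal.ofReal A → _ := fun A hA hWA =>
    conv_weakL3_L2_of_measurable hA hW.measurable_mk h₁.measurable_mk h₂.measurable_mk
      h₃.measurable_mk ((wLp_congr hW.ae_eq_mk).symm.trans_le hWA)
  have hF := Fprod_congr h₁.ae_eq_mk h₂.ae_eq_mk
  have hn₁ := eLpNorm_congr_ae (p := 2) h₁.ae_eq_mk
  have hdot : ∀ {u v : E3 → ℂ}, u =ᵐ[volume] v → hdotNorm u = hdotNorm v := fun h =>
    eLpNorm_congr_ae (h.mono fun k hk => congrArg (fun z => (‖k‖ : ℂ) * z) hk)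
  have hw : wLp (3 / 2) (fun k : E3 => ((W k : ℝ) : ℂ) * Fprod u₁ u₂ k) =
      wLp (3 / 2) (fun k : E3 => ((hW.mk W k : ℝ) : ℂ) * Fprod (h₁.mk u₁) (h₂.mk u₂) k) := by
    rw [hF]
    exact wLp_congr (hW.ae_eq_mk.mono fun k hk => by simp only [hk])
  have hint : ∀ k : E3, ∫ m : E3, ((W m : ℝ) : ℂ) * Fprod u₁ u₂ m * u₃ (k - m) =
      ∫ m : E3, ((hW.mk W m : ℝ) : ℂ) * Fprod (h₁.mk u₁) (h₂.mk u₂) m * h₃.mk u₃ (k - m) := by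
    intro k
    rw [hF]
    refine integral_congr_ae ?_
    filter_upwards [hW.ae_eq_mk, ae_eq_comp_sub_left h₃.ae_eq_mk k] with m hm hm'
    rw [hm, hm']
  simp only [← hint, ← hw, ← hn₁, ← hdot h₂.ae_eq_mk, ← hdot h₃.ae_eq_mk] at hmain
  constructor
  · refine (hmain ((wLp 3 W).toReal + 1) (by positivity) ?_).1 hu₁ hu₂
    rw [← ENNReal.ofReal_toReal hWfin.ne]
    exact ENNReal.ofReal_le_ofReal (by simp)
  · have hlim : Filter.Tendsto (fun a : ℝ≥0∞ =>
        ENNReal.ofReal weightConst * a * eLpNorm u₁ 2 volume * hdotNorm u₂ * hdotNorm u₃)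
        (nhdsWithin (wLp 3 W) (Set.Ioi (wLp 3 W)))
        (nhds (ENNReal.ofReal weightConst * wLp 3 W * eLpNorm u₁ 2 volume * hdotNorm u₂ *
          hdotNorm u₃)) := by
      refine Filter.Tendsto.mono_left (Continuous.tendsto ?_ _) nhdsWithin_le_nhds
      exact (ENNReal.continuous_mul_const hu₃.ne).comp ((ENNReal.continuous_mul_const hu₂.ne).comp
        ((ENNReal.continuous_mul_const hu₁.ne).comp
          (ENNReal.continuous_const_mul ENNReal.ofReal_ne_top)))
    have : (nhdsWithin (wLp 3 W) (Set.Ioi (wLp 3 W))).NeBot :=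
      nhdsGT_neBot_of_exists_gt ⟨∞, hWfin⟩
    refine ge_of_tendsto hlim ?_
    filter_upwards [Ioo_mem_nhdsGT hWfin] with a ha
    have ha0 : 0 < a.toReal :=
      ENNReal.toReal_pos (ne_bot_of_gt ha.1) ha.2.ne
    have := (hmain a.toReal ha0 (by rw [ENNReal.ofReal_toReal ha.2.ne]; exact ha.1.le)).2
    rwa [ENNReal.ofReal_mul weightConst_pos.le, ENNReal.ofReal_toReal ha.2.ne] at this
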